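/- Let a > 0, b > c > 0 with b + c > a, set ω₁ = √((b + c)² − a²) and τ₁ = arccos(−a/(b + c))/ω₁. Then for τ > 0, every complex root λ of the characteristic equation (λ + a + b e^{−λτ})² − c² e^{−2λτ} = 0 has strictly negative real part if and only if τ < τ₁. -/

import Mathlib

open Real in
theorem aux_stable (a k K τ x y : ℝ) (ha : 0 < a) (hk : 0 < k) (hkK : k ≤ K) (haK : a < K)
    (hτ : 0 < τ) (hx : 0 ≤ x) (hy : 0 ≤ y)
    (h1 : x + a + k * exp (-(x * τ)) * cos (y * τ) = 0)
    (h2 : y = k * exp (-(x * τ)) * sin (y * τ))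
    (hlt : τ < arccos (-a / K) / sqrt (K ^ 2 - a ^ 2)) : False := by
  have hK : 0 < K := by linarith
  have hw : 0 < K ^ 2 - a ^ 2 := by nlinarith
  have hE0 := exp_pos (-(x * τ))
  have hE1 : exp (-(x * τ)) ≤ 1 := exp_le_one_iff.2 (by have := mul_nonneg hx hτ.le; linarith)
  set E := exp (-(x * τ))
  have hm0 : 0 < k * E := mul_pos hk hE0
  have hm : k * E ≤ K := by nlinarith
  set m := k * E
  have hsq : (x + a) ^ 2 + y ^ 2 = m ^ 2 := by
    have e1 : x + a = - (m * cos (y * τ)) := by linarith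
    have e2 : y ^ 2 = (m * sin (y * τ)) ^ 2 := by rw [← h2]
    rw [e1, e2]
    nlinarith [sin_sq_add_cos_sq (y * τ)]
  have hyw : y ≤ sqrt (K ^ 2 - a ^ 2) := by
    apply le_sqrt_of_sq_le
    nlinarith
  have hs := sqrt_pos.2 hw
  rw [lt_div_iff₀ hs] at hlt
  have hyt : y * τ < arccos (-a / K) := by nlinarith
  have hcos : -a / K < cos (y * τ) := by
    have := cos_lt_cos_of_nonneg_of_le_pi (mul_nonneg hy hτ.le) (arccos_le_pi _) hyt
    rwa [cos_arccos] at this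
    · rw [le_div_iff₀ hK]; linarith
    · rw [div_le_iff₀ hK]; linarith
  rw [div_lt_iff₀ hK] at hcos
  rcases le_total 0 (cos (y * τ)) with hc | hc
  · nlinarith [mul_nonneg hm0.le hc]
  · nlinarith

open Real in
theorem aux_exists (a K τ : ℝ) (ha : 0 < a) (haK : a < K) (hτ : 0 < τ)
    (hle : arccos (-a / K) / sqrt (K ^ 2 - a ^ 2) ≤ τ) :
    ∃ x y : ℝ, 0 ≤ x ∧ x + a + K * exp (-(x * τ)) * cos (y * τ) = 0 ∧
      y = K * exp (-(x * τ)) * sin (y * τ) := by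
  have hK : 0 < K := by linarith
  have hw : 0 < K ^ 2 - a ^ 2 := by nlinarith
  have hs := sqrt_pos.2 hw
  have hneg : -a / K < 0 := div_neg_of_neg_of_pos (by linarith) hK
  have hgt : -1 < -a / K := by rw [lt_div_iff₀ hK]; linarith
  have hcos1 : cos (arccos (-a / K)) = -a / K := cos_arccos hgt.le (by linarith)
  have hsin1 : sin (arccos (-a / K)) = sqrt (K ^ 2 - a ^ 2) / K := by
    rw [sin_arccos, ← sqrt_sq hK.le, ← sqrt_div' _ (sq_nonneg _), sqrt_sq hK.le]
    congr 1
    field_simp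
  have ht1 : π / 2 < arccos (-a / K) := by
    by_contra hcon
    have := arccos_le_pi_div_two.1 (not_lt.1 hcon)
    linarith
  have ht2 : arccos (-a / K) < π := by
    refine lt_of_le_of_ne (arccos_le_pi _) ?_
    intro hcon
    have := arccos_eq_pi.1 hcon
    linarith
  set t1 := arccos (-a / K)
  set w := sqrt (K ^ 2 - a ^ 2)
  let X : ℝ → ℝ := fun t => -a - (t / τ) * (cos t / sin t)
  let g : ℝ → ℝ := fun t => K * exp (-(X t * τ)) * sin t - t / τ
  have hpi := pi_pos
  set D := π / (2 * τ * (K * exp (a * τ))) with hD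
  have hDpos : 0 < D := by positivity
  obtain ⟨t2, h12, h2pi, h2D⟩ : ∃ t2, t1 ≤ t2 ∧ t2 < π ∧ π - t2 ≤ D := by
    refine ⟨max t1 (π - D), le_max_left _ _, max_lt ht2 (by linarith), ?_⟩
    have := le_max_right t1 (π - D)
    linarith
  have hsinpos : ∀ t ∈ Set.Icc t1 t2, 0 < sin t := fun t ht =>
    sin_pos_of_pos_of_lt_pi (by linarith [ht.1]) (by linarith [ht.2])
  have hcosle : ∀ t ∈ Set.Icc t1 t2, cos t ≤ -a / K := fun t ht => by
    rw [← hcos1]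
    exact cos_le_cos_of_nonneg_of_le_pi (by linarith) (by linarith [ht.2]) ht.1
  have hcont : ContinuousOn g (Set.Icc t1 t2) := by
    have hX : ContinuousOn X (Set.Icc t1 t2) := by
      refine continuousOn_const.sub ((by fun_prop : Continuous fun t : ℝ => t / τ).continuousOn.mul ?_)
      exact continuous_cos.continuousOn.div continuous_sin.continuousOn fun t ht => (hsinpos t ht).ne'
    fun_prop
  have hg1 : 0 ≤ g t1 := by
    have hX1 : X t1 * τ ≤ 0 := by
      have : X t1 * τ = a * (t1 / w - τ) := by
        simp only [X]
        rw [hcos1, hsin1]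
        field_simp
        ring
      rw [this]
      exact mul_nonpos_of_nonneg_of_nonpos ha.le (by linarith)
    have hE : 1 ≤ exp (-(X t1 * τ)) := one_le_exp (by linarith)
    have h3 : t1 / τ ≤ w := by
      rw [div_le_iff₀ hs] at hle
      rw [div_le_iff₀ hτ]; linarith
    have h4 : K * exp (-(X t1 * τ)) * sin t1 = exp (-(X t1 * τ)) * w := by
      rw [hsin1]; field_simp
    simp only [g]
    rw [h4]
    nlinarith
  have hg2 : g t2 ≤ 0 := by
    have hm : t2 ∈ Set.Icc t1 t2 := ⟨h12, le_rfl⟩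
    have hX2 : -a ≤ X t2 := by
      have h5 : (t2 / τ) * (cos t2 / sin t2) ≤ 0 := by
        apply mul_nonpos_of_nonneg_of_nonpos
        · apply div_nonneg _ hτ.le; linarith
        · apply div_nonpos_of_nonpos_of_nonneg _ (hsinpos _ hm).le
          linarith [hcosle _ hm]
      simp only [X]; linarith
    have hE : exp (-(X t2 * τ)) ≤ exp (a * τ) := exp_le_exp.2 (by nlinarith)
    have hsin : sin t2 ≤ D := by
      rw [← sin_pi_sub]
      exact (sin_le (by linarith)).trans h2D
    have h6 : K * exp (-(X t2 * τ)) * sin t2 ≤ K * exp (a * τ) * D := by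
      have := (hsinpos _ hm).le
      gcongr
    have h7 : K * exp (a * τ) * D = (π / 2) / τ := by
      rw [hD]; field_simp
    have h8 : (π / 2) / τ ≤ t2 / τ := by gcongr; linarith
    simp only [g]; linarith
  obtain ⟨t, ht, hgt0⟩ := intermediate_value_Icc' h12 hcont ⟨hg2, hg1⟩
  have hst := hsinpos t ht
  have hct := hcosle t ht
  simp only [g] at hgt0
  have hy : t / τ = K * exp (-(X t * τ)) * sin t := by linarith
  have hXa : X t + a + K * exp (-(X t * τ)) * cos t = 0 := by
    have : X t + a = - ((t / τ) * (cos t / sin t)) := by simp only [X]; ring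
    rw [this, hy]; field_simp; ring
  refine ⟨X t, t / τ, ?_, ?_, ?_⟩
  · by_contra hcon
    push Not at hcon
    have hE : 1 ≤ exp (-(X t * τ)) := one_le_exp (by nlinarith)
    rw [le_div_iff₀ hK] at hct
    nlinarith
  · rwa [div_mul_cancel₀ _ hτ.ne']
  · rwa [div_mul_cancel₀ _ hτ.ne']

theorem aux_iff (a k τ : ℝ) (z : ℂ) :
    z + (a : ℂ) + (k : ℂ) * Complex.exp (-(z * (τ : ℂ))) = 0 ↔
      (z.re + a + k * Real.exp (-(z.re * τ)) * Real.cos (z.im * τ) = 0 ∧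
       z.im = k * Real.exp (-(z.re * τ)) * Real.sin (z.im * τ)) := by
  rw [Complex.ext_iff]
  simp [Complex.exp_re, Complex.exp_im]
  constructor <;> rintro ⟨h1, h2⟩ <;> constructor <;> linarith

/-- For `a > 0`, `b > c > 0`, `b + c > a`, and `τ > 0`, every complex root of
`(λ + a + b e^{-λτ})² - c² e^{-2λτ} = 0` has strictly negative real part iff
`τ < τ₁ = arccos(-a/(b+c))/√((b+c)² - a²)`. -/
theorem stmt11 (a b c : ℝ) (ha : 0 < a) (hc : 0 < c) (hcb : c < b)
    (h : a < b + c) (τ : ℝ) (hτ : 0 < τ) :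
    (∀ lam : ℂ,
      (lam + (a : ℂ) + (b : ℂ) * Complex.exp (-(lam * (τ : ℂ)))) ^ 2 -
          (c : ℂ) ^ 2 * Complex.exp (-(2 * lam * (τ : ℂ))) = 0 →
        lam.re < 0) ↔
      τ < Real.arccos (-a / (b + c)) / Real.sqrt ((b + c) ^ 2 - a ^ 2) := by
  have hfac : ∀ z : ℂ, (z + (a : ℂ) + (b : ℂ) * Complex.exp (-(z * (τ : ℂ)))) ^ 2 -
          (c : ℂ) ^ 2 * Complex.exp (-(2 * z * (τ : ℂ))) =
      (z + (a : ℂ) + ((b + c : ℝ) : ℂ) * Complex.exp (-(z * (τ : ℂ)))) *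
      (z + (a : ℂ) + ((b - c : ℝ) : ℂ) * Complex.exp (-(z * (τ : ℂ)))) := by
    intro z
    have : Complex.exp (-(2 * z * (τ : ℂ))) = Complex.exp (-(z * (τ : ℂ))) ^ 2 := by
      rw [← Complex.exp_nat_mul]; congr 1; push_cast; ring
    rw [this]; push_cast; ring
  constructor
  · intro hall
    by_contra hcon
    obtain ⟨x, y, hx, h1, h2⟩ := aux_exists a (b + c) τ ha h hτ (not_lt.1 hcon)
    have := hall ⟨x, y⟩ (by
      rw [hfac, (aux_iff a (b + c) τ ⟨x, y⟩).2 ⟨h1, h2⟩, zero_mul])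
    simp at this
    linarith
  · intro hlt z hz
    rw [hfac] at hz
    by_contra hcon
    push Not at hcon
    have key : ∀ k : ℝ, 0 < k → k ≤ b + c →
        z + (a : ℂ) + (k : ℂ) * Complex.exp (-(z * (τ : ℂ))) = 0 → False := by
      intro k hk hkK hk0
      obtain ⟨h1, h2⟩ := (aux_iff a k τ z).1 hk0
      rcases le_total 0 z.im with hy | hy
      · exact aux_stable a k (b + c) τ z.re z.im ha hk hkK h hτ hcon hy h1 h2 hlt
      · refine aux_stable a k (b + c) τ z.re (-z.im) ha hk hkK h hτ hcon (by linarith) ?_ ?_ hlt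
        · rwa [neg_mul, Real.cos_neg]
        · rw [neg_mul, Real.sin_neg]; linarith
    rcases mul_eq_zero.1 hz with h0 | h0
    · exact key _ (by linarith) le_rfl h0
    · exact key _ (by linarith) (by linarith) h0
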